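/- arXiv:1910.05415 — 5 statements merged into one kernel-verified Lean document; each statement's English description precedes it below -/
import Mathlib

section
/- Let S be a 3×3 real symmetric matrix with tr(S) = 0 and let ω ∈ ℝ³. Then tr((S + A(ω))³) = 3 det(S) + (3/4)⟨ω, S ω⟩, where ⟨ω, Sω⟩ = Σᵢⱼ Sᵢⱼ ωᵢ ωⱼ. -/
open Matrix

/-- The antisymmetric matrix associated with the vorticity vector `ω`:
`A(ω) = (1/2) [[0, ω₃, −ω₂], [−ω₃, 0, ω₁], [ω₂, −ω₁, 0]]`. -/
noncomputable def Amat (ω : Fin 3 → ℝ) : Matrix (Fin 3) (Fin 3) ℝ :=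
  (1 / 2 : ℝ) • !![0, ω 2, -(ω 1); -(ω 2), 0, ω 0; ω 1, -(ω 0), 0]

theorem trace_cube_strain_add_Amat (S : Matrix (Fin 3) (Fin 3) ℝ)
    (hS : Sᵀ = S) (htr : S.trace = 0) (ω : Fin 3 → ℝ) :
    ((S + Amat ω) ^ 3).trace
      = 3 * S.det + (3 / 4 : ℝ) * ∑ i, ∑ j, S i j * ω i * ω j := by
  have h10 : S 1 0 = S 0 1 := congrFun (congrFun hS 0) 1
  have h20 : S 2 0 = S 0 2 := congrFun (congrFun hS 0) 2
  have h21 : S 2 1 = S 1 2 := congrFun (congrFun hS 1) 2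
  have h22 : S 2 2 = -S 0 0 - S 1 1 := by
    rw [trace_fin_three] at htr
    linarith
  simp only [pow_succ, pow_zero, one_mul, trace_fin_three, det_fin_three, mul_apply,
    Fin.sum_univ_three, Matrix.add_apply, Amat, Matrix.smul_apply, smul_eq_mul, of_apply,
    cons_val, h10, h20, h21, h22]
  ring
end

section
/- Let λ₁ ≤ λ₂ ≤ λ₃ be real numbers with λ₁ + λ₂ + λ₃ = 0. Then λ₁ ≤ 0, λ₃ ≥ 0, and −λ₁λ₂λ₃ ≤ (1/2) max(λ₂, 0) (λ₁² + λ₂² + λ₃²). -/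
theorem middle_eigenvalue_det_bound (l1 l2 l3 : ℝ)
    (h12 : l1 ≤ l2) (h23 : l2 ≤ l3) (hsum : l1 + l2 + l3 = 0) :
    l1 ≤ 0 ∧ 0 ≤ l3 ∧
      -(l1 * l2 * l3) ≤ (1 / 2 : ℝ) * max l2 0 * (l1 ^ 2 + l2 ^ 2 + l3 ^ 2) := by
  have h1 : l1 ≤ 0 := by linarith
  have h3 : 0 ≤ l3 := by linarith
  refine ⟨h1, h3, ?_⟩
  rcases le_total l2 0 with h2 | h2
  · have hdet : 0 ≤ l1 * l2 * l3 := mul_nonneg (mul_nonneg_of_nonpos_of_nonpos h1 h2) h3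
    rw [max_eq_right h2]
    linarith
  · rw [max_eq_left h2]
    have hsq : 0 ≤ l2 * ((l1 + l3) ^ 2 + l2 ^ 2) := by positivity
    linarith
end

section
/- Let u : ℝ³ → ℝ³ be smooth with compact support and divergence free, i.e. div u = 0 everywhere. Then ∫_{ℝ³} tr((Du)³) dx = 0, where Du is the Jacobian matrix of u. -/
open Matrix MeasureTheory

/-- Partial derivative `∂ᵢ f` of a scalar field on `ℝ³`. -/
noncomputable def pd (i : Fin 3) (f : (Fin 3 → ℝ) → ℝ) (x : Fin 3 → ℝ) : ℝ :=
  fderiv ℝ f x (Pi.single i 1)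

/-- The Jacobian matrix of `u : ℝ³ → ℝ³`, with entries `(Du)ᵢⱼ = ∂ᵢuⱼ`. -/
noncomputable def jacobian (u : (Fin 3 → ℝ) → (Fin 3 → ℝ)) (x : Fin 3 → ℝ) :
    Matrix (Fin 3) (Fin 3) ℝ :=
  Matrix.of fun i j => pd i (fun y => u y j) x

/-- The strain matrix `∇_sym u = (1/2)(Du + Duᵀ)`. -/
noncomputable def strain (u : (Fin 3 → ℝ) → (Fin 3 → ℝ)) (x : Fin 3 → ℝ) :
    Matrix (Fin 3) (Fin 3) ℝ :=
  (1 / 2 : ℝ) • (jacobian u x + (jacobian u x)ᵀ)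

/-- The divergence `div u = Σᵢ ∂ᵢuᵢ`. -/
noncomputable def div3 (u : (Fin 3 → ℝ) → (Fin 3 → ℝ)) (x : Fin 3 → ℝ) : ℝ :=
  ∑ i, pd i (fun y => u y i) x

/-- The curl `curl u = (∂₂u₃−∂₃u₂, ∂₃u₁−∂₁u₃, ∂₁u₂−∂₂u₁)`. -/
noncomputable def curl3 (u : (Fin 3 → ℝ) → (Fin 3 → ℝ)) (x : Fin 3 → ℝ) : Fin 3 → ℝ :=
  ![pd 1 (fun y => u y 2) x - pd 2 (fun y => u y 1) x,
    pd 2 (fun y => u y 0) x - pd 0 (fun y => u y 2) x,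
    pd 0 (fun y => u y 1) x - pd 1 (fun y => u y 0) x]

theorem ContDiff.pd {f : (Fin 3 → ℝ) → ℝ} (hf : ContDiff ℝ (⊤ : ℕ∞) f) (i : Fin 3) :
    ContDiff ℝ (⊤ : ℕ∞) (pd i f) :=
  (hf.fderiv_right (m := (⊤ : ℕ∞)) (by simp)).clm_apply contDiff_const

theorem HasCompactSupport.pd {f : (Fin 3 → ℝ) → ℝ} (hf : HasCompactSupport f) (i : Fin 3) :
    HasCompactSupport (pd i f) :=
  hf.fderiv_apply ℝ (Pi.single i 1)

theorem pd_mul {f g : (Fin 3 → ℝ) → ℝ} (hf : Differentiable ℝ f) (hg : Differentiable ℝ g)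
    (i : Fin 3) (x : Fin 3 → ℝ) :
    pd i (fun y => f y * g y) x = f x * pd i g x + g x * pd i f x := by
  simp [pd, fderiv_fun_mul (hf x) (hg x)]

theorem pd_sub {f g : (Fin 3 → ℝ) → ℝ} (hf : Differentiable ℝ f) (hg : Differentiable ℝ g)
    (i : Fin 3) (x : Fin 3 → ℝ) :
    pd i (fun y => f y - g y) x = pd i f x - pd i g x := by
  simp [pd, fderiv_fun_sub (hf x) (hg x)]

/-- Mixed second partial derivatives of a smooth function commute. -/
theorem pd_comm {f : (Fin 3 → ℝ) → ℝ} (hf : ContDiff ℝ (⊤ : ℕ∞) f) (i j : Fin 3)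
    (x : Fin 3 → ℝ) : pd i (pd j f) x = pd j (pd i f) x := by
  have hd : DifferentiableAt ℝ (fderiv ℝ f) x :=
    ((hf.fderiv_right (m := (⊤ : ℕ∞)) (by simp)).differentiable (by simp)) x
  have key (i j : Fin 3) :
      pd i (pd j f) x = fderiv ℝ (fderiv ℝ f) x (Pi.single i 1) (Pi.single j 1) := by
    change fderiv ℝ (fun y => fderiv ℝ f y (Pi.single j 1)) x (Pi.single i 1) = _
    simp [fderiv_clm_apply hd (differentiableAt_const _)]
  rw [key, key]
  exact (hf.contDiffAt.isSymmSndFDerivAt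
    (by simpa using WithTop.coe_le_coe.2 (le_top : (2 : ℕ∞) ≤ ⊤))).eq _ _

theorem integrable_pd {f : (Fin 3 → ℝ) → ℝ} (hf : ContDiff ℝ (⊤ : ℕ∞) f)
    (hc : HasCompactSupport f) (i : Fin 3) : Integrable (pd i f) :=
  (hf.pd i).continuous.integrable_of_hasCompactSupport (hc.pd i)

theorem integral_pd_eq_zero {f : (Fin 3 → ℝ) → ℝ} (hf : ContDiff ℝ (⊤ : ℕ∞) f)
    (hc : HasCompactSupport f) (i : Fin 3) : ∫ x, pd i f x = 0 := by
  have h := integral_mul_fderiv_eq_neg_fderiv_mul_of_integrable (μ := volume)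
    (f := fun _ : Fin 3 → ℝ => (1 : ℝ)) (g := f) (v := Pi.single i 1) (by simp)
    (by simp only [one_mul]; exact integrable_pd hf hc i)
    (by simpa using hf.continuous.integrable_of_hasCompactSupport hc)
    (fun _ _ => differentiableAt_const _) (fun x _ => hf.differentiable (by simp) x)
  simpa [pd] using h

theorem trace_pow_three_of_trace_eq_zero {R : Type*} [CommRing R] (A : Matrix (Fin 3) (Fin 3) R)
    (hA : A.trace = 0) : (A ^ 3).trace = 3 * A.det := by
  rw [Matrix.trace_fin_three] at hA
  have h : A 2 2 = -A 0 0 - A 1 1 := by linear_combination hA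
  simp only [pow_succ, pow_zero, one_mul, Matrix.trace_fin_three, Matrix.det_fin_three,
    Matrix.mul_apply, Fin.sum_univ_three, h]
  ring

/-- The function `f (∂ⱼg ∂ₖh - ∂ₖg ∂ⱼh)`. -/
noncomputable def mulMinor (f g h : (Fin 3 → ℝ) → ℝ) (j k : Fin 3) (x : Fin 3 → ℝ) : ℝ :=
  f x * (pd j g x * pd k h x - pd k g x * pd j h x)

section mulMinor

variable {f g h : (Fin 3 → ℝ) → ℝ}

theorem contDiff_mulMinor (hf : ContDiff ℝ (⊤ : ℕ∞) f) (hg : ContDiff ℝ (⊤ : ℕ∞) g)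
    (hh : ContDiff ℝ (⊤ : ℕ∞) h) (j k : Fin 3) :
    ContDiff ℝ (⊤ : ℕ∞) (mulMinor f g h j k) :=
  hf.mul (((hg.pd j).mul (hh.pd k)).sub ((hg.pd k).mul (hh.pd j)))

theorem hasCompactSupport_mulMinor (hf : HasCompactSupport f) (j k : Fin 3) :
    HasCompactSupport (mulMinor f g h j k) :=
  hf.mul_right

theorem pd_mulMinor (hf : ContDiff ℝ (⊤ : ℕ∞) f) (hg : ContDiff ℝ (⊤ : ℕ∞) g)
    (hh : ContDiff ℝ (⊤ : ℕ∞) h) (i j k : Fin 3) (x : Fin 3 → ℝ) :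
    pd i (mulMinor f g h j k) x =
      f x * (pd j g x * pd i (pd k h) x + pd k h x * pd i (pd j g) x
        - (pd k g x * pd i (pd j h) x + pd j h x * pd i (pd k g) x))
      + (pd j g x * pd k h x - pd k g x * pd j h x) * pd i f x := by
  have hd {φ : (Fin 3 → ℝ) → ℝ} (hφ : ContDiff ℝ (⊤ : ℕ∞) φ) : Differentiable ℝ φ :=
    hφ.differentiable (by simp)
  have hg' (l : Fin 3) := hd (hg.pd l)
  have hh' (l : Fin 3) := hd (hh.pd l)
  unfold mulMinor
  rw [pd_mul (hd hf) (((hg' j).fun_mul (hh' k)).fun_sub ((hg' k).fun_mul (hh' j))),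
    pd_sub ((hg' j).fun_mul (hh' k)) ((hg' k).fun_mul (hh' j)), pd_mul (hg' j) (hh' k),
    pd_mul (hg' k) (hh' j)]

end mulMinor

/-- The Jacobian determinant is a divergence. -/
theorem det_jacobian_eq_sum_pd {u : (Fin 3 → ℝ) → (Fin 3 → ℝ)}
    (hu : ∀ j, ContDiff ℝ (⊤ : ℕ∞) fun y => u y j) (x : Fin 3 → ℝ) :
    (jacobian u x).det =
      ∑ i, pd i (mulMinor (fun y => u y 0) (fun y => u y 1) (fun y => u y 2) (i + 1) (i + 2)) x := by
  simp only [Fin.sum_univ_three, pd_mulMinor (hu 0) (hu 1) (hu 2), Matrix.det_fin_three, jacobian,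
    Matrix.of_apply, Fin.isValue, zero_add, Fin.reduceAdd]
  rw [pd_comm (hu 1) 1 0, pd_comm (hu 1) 2 0, pd_comm (hu 1) 2 1,
    pd_comm (hu 2) 1 0, pd_comm (hu 2) 2 0, pd_comm (hu 2) 2 1]
  ring

/-- The Jacobian determinant of a smooth compactly supported vector field has zero integral. -/
theorem integral_det_jacobian_eq_zero {u : (Fin 3 → ℝ) → (Fin 3 → ℝ)}
    (hu : ∀ j, ContDiff ℝ (⊤ : ℕ∞) fun y => u y j) (hc : HasCompactSupport fun y => u y 0) :
    ∫ x, (jacobian u x).det = 0 := by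
  simp_rw [det_jacobian_eq_sum_pd hu]
  have hF (i : Fin 3) := contDiff_mulMinor (hu 0) (hu 1) (hu 2) (i + 1) (i + 2)
  have hFc (i : Fin 3) := hasCompactSupport_mulMinor (g := fun y => u y 1) (h := fun y => u y 2)
    hc (i + 1) (i + 2)
  rw [integral_finsetSum _ fun i _ => integrable_pd (hF i) (hFc i) i]
  exact Finset.sum_eq_zero fun i _ => integral_pd_eq_zero (hF i) (hFc i) i

theorem integral_trace_jacobian_cubed (u : (Fin 3 → ℝ) → (Fin 3 → ℝ))
    (hsmooth : ContDiff ℝ (⊤ : ℕ∞) u) (hsupp : HasCompactSupport u)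
    (hdiv : ∀ x, div3 u x = 0) :
    ∫ x : Fin 3 → ℝ, ((jacobian u x) ^ 3).trace = 0 := by
  have htrace (x : Fin 3 → ℝ) : (jacobian u x).trace = 0 := hdiv x
  simp_rw [fun x => trace_pow_three_of_trace_eq_zero (jacobian u x) (htrace x)]
  rw [integral_const_mul, integral_det_jacobian_eq_zero (contDiff_pi.1 hsmooth)
    (hsupp.comp_left (g := fun v : Fin 3 → ℝ => v 0) rfl), mul_zero]
end

section
/- The following double integral identity holds: π ∫₀^∞ ∫₀^∞ w √v (1 − 2v)(−7 + 2v + 2w)² exp(−3w − 3v) dv dw = 8π^{3/2} / (81√3). In particular this quantity is strictly positive. -/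
open MeasureTheory Real

theorem integrableOn_rpow_mul_exp_neg_mul_Ioi {s b : ℝ} (hs : -1 < s) (hb : 0 < b) :
    IntegrableOn (fun x : ℝ => x ^ s * Real.exp (-(b * x))) (Set.Ioi 0) := by
  simpa using integrableOn_rpow_mul_exp_neg_mul_rpow hs one_pos hb

theorem integral_rpow_mul_exp_neg_mul_Ioi_eq {s b : ℝ} (hs : -1 < s) (hb : 0 < b) :
    ∫ x in Set.Ioi (0 : ℝ), x ^ s * Real.exp (-(b * x))
      = (1 / b) ^ (s + 1) * Real.Gamma (s + 1) := by
  have h := Real.integral_rpow_mul_exp_neg_mul_Ioi (a := s + 1) (by linarith) hb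
  simpa using h

theorem integral_sum_rpow_mul_exp_neg_mul_Ioi (n : ℕ) (a : ℕ → ℝ) {s b : ℝ} (hs : -1 < s)
    (hb : 0 < b) :
    ∫ x in Set.Ioi (0 : ℝ), ∑ i ∈ Finset.range n, a i * (x ^ (s + i) * Real.exp (-(b * x)))
      = ∑ i ∈ Finset.range n, a i * ((1 / b) ^ (s + i + 1) * Real.Gamma (s + i + 1)) := by
  have hs' (i : ℕ) : -1 < s + i := by
    have : (0 : ℝ) ≤ i := i.cast_nonneg
    linarith
  rw [integral_finsetSum _ fun i _ =>
    (integrableOn_rpow_mul_exp_neg_mul_Ioi (hs' i) hb).const_mul (a i)]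
  simp_rw [integral_const_mul, integral_rpow_mul_exp_neg_mul_Ioi_eq (hs' _) hb]

/-- The recursion satisfied by the moments of `exp (-b x)` on the half-line. -/
theorem one_div_rpow_mul_Gamma_add_one {t b : ℝ} (ht : 0 < t) (hb : 0 < b) :
    (1 / b) ^ (t + 1) * Real.Gamma (t + 1) = t / b * ((1 / b) ^ t * Real.Gamma t) := by
  rw [rpow_add_one (by positivity), Real.Gamma_add_one ht.ne']
  ring

theorem integral_cubic_mul_sqrt_mul_exp_neg (a b c d : ℝ) :
    ∫ v in Set.Ioi (0 : ℝ), (a + b * v + c * v ^ 2 + d * v ^ 3)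
        * (√v * Real.exp (-(3 * v)))
      = (a / 6 + b / 12 + c * (5 / 72) + d * (35 / 432)) * (√π / √3) := by
  have h := integral_sum_rpow_mul_exp_neg_mul_Ioi 4
    (fun i => if i = 0 then a else if i = 1 then b else if i = 2 then c else d) (s := 1 / 2) (b := 3)
    (by norm_num) (by norm_num)
  have h0 : ((1 : ℝ) / 3) ^ ((1 : ℝ) / 2) * Real.Gamma (1 / 2) = √π / √3 := by
    rw [Real.Gamma_one_half_eq, ← sqrt_eq_rpow, sqrt_div zero_le_one, sqrt_one]
    ring
  have h1 := one_div_rpow_mul_Gamma_add_one (t := 1 / 2) (b := 3) (by norm_num) (by norm_num)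
  have h2 := one_div_rpow_mul_Gamma_add_one (t := 1 / 2 + 1) (b := 3) (by norm_num) (by norm_num)
  have h3 := one_div_rpow_mul_Gamma_add_one (t := 1 / 2 + 1 + 1) (b := 3)
    (by norm_num) (by norm_num)
  have h4 := one_div_rpow_mul_Gamma_add_one (t := 1 / 2 + 1 + 1 + 1) (b := 3)
    (by norm_num) (by norm_num)
  rw [h0] at h1
  rw [h1] at h2
  rw [h2] at h3
  rw [h3] at h4
  have e2 : (1 / 2 : ℝ) + ((1 : ℕ) : ℝ) + 1 = 1 / 2 + 1 + 1 := by norm_num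
  have e3 : (1 / 2 : ℝ) + ((2 : ℕ) : ℝ) + 1 = 1 / 2 + 1 + 1 + 1 := by norm_num
  have e4 : (1 / 2 : ℝ) + ((3 : ℕ) : ℝ) + 1 = 1 / 2 + 1 + 1 + 1 + 1 := by norm_num
  have e1 : (1 / 2 : ℝ) + ((0 : ℕ) : ℝ) + 1 = 1 / 2 + 1 := by norm_num
  simp only [Finset.sum_range_succ _ 3, Finset.sum_range_succ _ 2, Finset.sum_range_succ _ 1,
    Finset.sum_range_one, reduceIte, OfNat.ofNat_ne_zero, OfNat.ofNat_ne_one, one_ne_zero,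
    Nat.reduceEqDiff, e1, e2, e3, e4, h1, h2, h3, h4] at h
  refine (setIntegral_congr_fun measurableSet_Ioi fun v (hv : 0 < v) => ?_).trans (h.trans ?_)
  · simp only [sqrt_eq_rpow]
    have e (i : ℕ) : v ^ ((1 : ℝ) / 2 + i) = v ^ ((1 : ℝ) / 2) * v ^ i := by
      rw [rpow_add hv, rpow_natCast]
    show _ = a * (v ^ ((1 : ℝ) / 2 + (0 : ℕ)) * Real.exp (-(3 * v)))
      + b * (v ^ ((1 : ℝ) / 2 + (1 : ℕ)) * Real.exp (-(3 * v)))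
      + c * (v ^ ((1 : ℝ) / 2 + (2 : ℕ)) * Real.exp (-(3 * v)))
      + d * (v ^ ((1 : ℝ) / 2 + (3 : ℕ)) * Real.exp (-(3 * v)))
    simp only [e]
    ring
  · ring

theorem integral_linear_mul_self_mul_exp_neg (a b : ℝ) :
    ∫ w in Set.Ioi (0 : ℝ), (a + b * w) * (w * Real.exp (-(3 * w))) = a / 9 + b * (2 / 27) := by
  have h := integral_sum_rpow_mul_exp_neg_mul_Ioi 2 (fun i => if i = 0 then a else b)
    (s := 1) (b := 3) (by norm_num) (by norm_num)
  have h1 := one_div_rpow_mul_Gamma_add_one (t := 1) (b := 3) (by norm_num) (by norm_num)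
  have h2 := one_div_rpow_mul_Gamma_add_one (t := 1 + 1) (b := 3) (by norm_num) (by norm_num)
  rw [h1] at h2
  simp only [Finset.sum_range_succ _ 1, Finset.sum_range_one, Nat.cast_zero, Nat.cast_one,
    add_zero, h1, h2, Real.Gamma_one, rpow_one, one_ne_zero, if_true, if_false] at h
  refine (setIntegral_congr_fun measurableSet_Ioi fun w (hw : 0 < w) => ?_).trans (h.trans ?_)
  · show _ = a * (w * Real.exp (-(3 * w)))
      + b * (w ^ ((1 : ℝ) + 1) * Real.exp (-(3 * w)))
    rw [rpow_add_one hw.ne', rpow_one]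
    ring
  · ring

theorem integral_integral_swirl_free_density :
    ∫ w in Set.Ioi (0 : ℝ), ∫ v in Set.Ioi (0 : ℝ),
        w * √v * (1 - 2 * v) * (-7 + 2 * v + 2 * w) ^ 2 * Real.exp (-3 * w - 3 * v)
      = 8 / 81 * (√π / √3) := by
  have inner (w : ℝ) : ∫ v in Set.Ioi (0 : ℝ),
        w * √v * (1 - 2 * v) * (-7 + 2 * v + 2 * w) ^ 2 * Real.exp (-3 * w - 3 * v)
      = (√π / √3) * ((32 / 27 + -4 / 9 * w) * (w * Real.exp (-(3 * w)))) := by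
    have h := integral_cubic_mul_sqrt_mul_exp_neg ((2 * w - 7) ^ 2)
      (4 * (2 * w - 7) - 2 * (2 * w - 7) ^ 2) (4 - 8 * (2 * w - 7)) (-8)
    calc
      _ = ∫ v in Set.Ioi (0 : ℝ), w * Real.exp (-(3 * w)) *
          (((2 * w - 7) ^ 2 + (4 * (2 * w - 7) - 2 * (2 * w - 7) ^ 2) * v
            + (4 - 8 * (2 * w - 7)) * v ^ 2 + -8 * v ^ 3) * (√v * Real.exp (-(3 * v)))) := by
        congr 1 with v
        rw [show -3 * w - 3 * v = -(3 * w) + -(3 * v) by ring, Real.exp_add]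
        ring
      _ = _ := by
        rw [integral_const_mul, h]
        ring
  simp_rw [inner, integral_const_mul, integral_linear_mul_self_mul_exp_neg]
  ring

theorem explicit_double_integral_value :
    (Real.pi * ∫ w in Set.Ioi (0 : ℝ), ∫ v in Set.Ioi (0 : ℝ),
          w * Real.sqrt v * (1 - 2 * v) * (-7 + 2 * v + 2 * w) ^ 2
            * Real.exp (-3 * w - 3 * v))
        = 8 * Real.pi ^ ((3 : ℝ) / 2) / (81 * Real.sqrt 3)
      ∧ 0 < Real.pi * ∫ w in Set.Ioi (0 : ℝ), ∫ v in Set.Ioi (0 : ℝ),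
          w * Real.sqrt v * (1 - 2 * v) * (-7 + 2 * v + 2 * w) ^ 2
            * Real.exp (-3 * w - 3 * v) := by
  rw [integral_integral_swirl_free_density]
  refine ⟨?_, by positivity⟩
  rw [show (3 : ℝ) / 2 = 1 + 1 / 2 by norm_num, rpow_add pi_pos, rpow_one, ← sqrt_eq_rpow]
  ring
end

section
/- Define u : ℝ³ → ℝ³ by u(x) = exp(−(x₁² + x₂² + x₃²)) · ((1 − 2x₃²)x₁, (1 − 2x₃²)x₂, −2x₃ + 2(x₁² + x₂²)x₃), and let S = (1/2)(Du + Duᵀ) be its strain matrix. Then −∫_{ℝ³} det(S(x)) dx = 8π^{3/2} / (81√3) > 0. -/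
open Matrix MeasureTheory

/-- The explicit axisymmetric swirl-free velocity field
`u = (r − 2rz²)e^{−r²−z²} e_r + (−2z + 2r²z)e^{−r²−z²} e_z` in Cartesian coordinates. -/
noncomputable def uex (x : Fin 3 → ℝ) : Fin 3 → ℝ :=
  Real.exp (-(x 0 ^ 2 + x 1 ^ 2 + x 2 ^ 2)) •
    ![(1 - 2 * x 2 ^ 2) * x 0, (1 - 2 * x 2 ^ 2) * x 1,
      -2 * x 2 + 2 * (x 0 ^ 2 + x 1 ^ 2) * x 2]

/-- A scalar field on `ℝ³` that is integrable with integral `v`. -/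
def HasIntegral (f : (Fin 3 → ℝ) → ℝ) (v : ℝ) : Prop :=
  Integrable f ∧ ∫ x, f x = v

namespace HasIntegral

variable {f g : (Fin 3 → ℝ) → ℝ} {v w : ℝ}

theorem add (hf : HasIntegral f v) (hg : HasIntegral g w) :
    HasIntegral (fun x => f x + g x) (v + w) :=
  ⟨hf.1.add hg.1, by rw [integral_add hf.1 hg.1, hf.2, hg.2]⟩

theorem const_mul (c : ℝ) (hf : HasIntegral f v) : HasIntegral (fun x => c * f x) (c * v) :=
  ⟨hf.1.const_mul c, by rw [integral_const_mul, hf.2]⟩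

theorem congr (hf : HasIntegral f v) (hfg : ∀ x, g x = f x) (hvw : w = v) : HasIntegral g w := by
  obtain rfl : g = f := funext hfg
  rwa [hvw]

end HasIntegral

theorem integrable_pow_mul_exp_neg_mul_sq {b : ℝ} (hb : 0 < b) (n : ℕ) :
    Integrable fun t : ℝ => t ^ n * Real.exp (-b * t ^ 2) := by
  simpa using integrable_rpow_mul_exp_neg_mul_sq hb (s := n) (by linarith [n.cast_nonneg (α := ℝ)])

theorem integral_pow_add_two_mul_exp_neg_mul_sq {b : ℝ} (hb : 0 < b) (n : ℕ) :
    ∫ t : ℝ, t ^ (n + 2) * Real.exp (-b * t ^ 2) =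
      (n + 1) / (2 * b) * ∫ t : ℝ, t ^ n * Real.exp (-b * t ^ 2) := by
  have hint := integrable_pow_mul_exp_neg_mul_sq hb
  have hderiv (t : ℝ) : HasDerivAt (fun t : ℝ => t ^ (n + 1) * Real.exp (-b * t ^ 2))
      ((n + 1) * (t ^ n * Real.exp (-b * t ^ 2)) -
        2 * b * (t ^ (n + 2) * Real.exp (-b * t ^ 2))) t := by
    convert! (hasDerivAt_pow (n + 1) t).mul (((hasDerivAt_pow 2 t).const_mul (-b)).exp) using 1
    push_cast
    ring
  have h := integral_eq_zero_of_hasDerivAt_of_integrable hderiv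
    (((hint n).const_mul _).sub ((hint (n + 2)).const_mul _)) (hint (n + 1))
  rw [integral_sub ((hint n).const_mul _) ((hint (n + 2)).const_mul _), integral_const_mul,
    integral_const_mul] at h
  rw [div_mul_eq_mul_div, eq_div_iff (by positivity)]
  linarith

/-- The even moments up to order `8` of the unnormalized Gaussian `exp (-3 t ^ 2)`. -/
theorem integral_pow_mul_exp_neg_three_mul_sq :
    (∫ t : ℝ, t ^ 0 * Real.exp (-3 * t ^ 2)) = √(Real.pi / 3) ∧
    (∫ t : ℝ, t ^ 2 * Real.exp (-3 * t ^ 2)) = 1 / 6 * √(Real.pi / 3) ∧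
    (∫ t : ℝ, t ^ 4 * Real.exp (-3 * t ^ 2)) = 1 / 12 * √(Real.pi / 3) ∧
    (∫ t : ℝ, t ^ 6 * Real.exp (-3 * t ^ 2)) = 5 / 72 * √(Real.pi / 3) ∧
    (∫ t : ℝ, t ^ 8 * Real.exp (-3 * t ^ 2)) = 35 / 432 * √(Real.pi / 3) := by
  have step := integral_pow_add_two_mul_exp_neg_mul_sq (b := 3) (by norm_num)
  have h0 : (∫ t : ℝ, t ^ 0 * Real.exp (-3 * t ^ 2)) = √(Real.pi / 3) := by
    simpa using integral_gaussian 3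
  have h2 := step 0
  have h4 := step 2
  have h6 := step 4
  have h8 := step 6
  norm_num only [h0] at h2
  norm_num only [h2] at h4
  norm_num only [h4] at h6
  norm_num only [h6] at h8
  refine ⟨h0, h2.trans ?_, h4.trans ?_, h6.trans ?_, h8.trans ?_⟩ <;> ring

theorem hasIntegral_monomial_mul_gaussian (a b c : ℕ) :
    HasIntegral
      (fun x => x 0 ^ a * x 1 ^ b * x 2 ^ c * Real.exp (-3 * (x 0 ^ 2 + x 1 ^ 2 + x 2 ^ 2)))
      ((∫ t : ℝ, t ^ a * Real.exp (-3 * t ^ 2)) * (∫ t : ℝ, t ^ b * Real.exp (-3 * t ^ 2)) *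
        ∫ t : ℝ, t ^ c * Real.exp (-3 * t ^ 2)) := by
  let f (i : Fin 3) (t : ℝ) : ℝ := t ^ (![a, b, c] i) * Real.exp (-3 * t ^ 2)
  have hf : HasIntegral (fun x => ∏ i, f i (x i)) (∏ i, ∫ t, f i t) :=
    ⟨Integrable.fintype_prod fun i => integrable_pow_mul_exp_neg_mul_sq (by norm_num) _,
      integral_fintype_prod_volume_eq_prod f⟩
  refine hf.congr (fun x => ?_) (by simp [f, Fin.prod_univ_three])
  simp only [f, Fin.prod_univ_three, Matrix.cons_val, mul_add, Real.exp_add]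
  ring

theorem hasIntegral_radial_mul_gaussian (c : ℕ) {m : ℝ}
    (hm : (∫ t : ℝ, t ^ c * Real.exp (-3 * t ^ 2)) = m * √(Real.pi / 3)) (c₀ c₁ c₂ c₃ : ℝ) :
    HasIntegral
      (fun x => (c₀ + c₁ * (x 0 ^ 2 + x 1 ^ 2) + c₂ * (x 0 ^ 2 + x 1 ^ 2) ^ 2 +
        c₃ * (x 0 ^ 2 + x 1 ^ 2) ^ 3) * x 2 ^ c *
          Real.exp (-3 * (x 0 ^ 2 + x 1 ^ 2 + x 2 ^ 2)))
      ((c₀ + c₁ / 3 + c₂ * (2 / 9) + c₃ * (2 / 9)) * m * √(Real.pi / 3) ^ 3) := by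
  obtain ⟨h0, h2, h4, h6, -⟩ := integral_pow_mul_exp_neg_three_mul_sq
  have h (a b : ℕ) := hasIntegral_monomial_mul_gaussian a b c
  refine (((((h 0 0).const_mul c₀).add (((h 2 0).add (h 0 2)).const_mul c₁)).add
    ((((h 4 0).add ((h 2 2).const_mul 2)).add (h 0 4)).const_mul c₂)).add
    (((((h 6 0).add ((h 4 2).const_mul 3)).add ((h 2 4).const_mul 3)).add
      (h 0 6)).const_mul c₃)).congr (fun x => ?_) ?_
  · ring
  · rw [hm, h0, h2, h4, h6]
    ring

theorem pd_exp_neg_sq_mul (i : Fin 3) {p : (Fin 3 → ℝ) → ℝ} {x : Fin 3 → ℝ}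
    (hp : DifferentiableAt ℝ p x) :
    pd i (fun y => Real.exp (-(y 0 ^ 2 + y 1 ^ 2 + y 2 ^ 2)) * p y) x =
      Real.exp (-(x 0 ^ 2 + x 1 ^ 2 + x 2 ^ 2)) * (pd i p x - 2 * x i * p x) := by
  have hc (k : Fin 3) := hasFDerivAt_apply (𝕜 := ℝ) k x
  have h := ((((hc 0).pow 2).add ((hc 1).pow 2)).add ((hc 2).pow 2)).neg.exp.mul hp.hasFDerivAt
  have h' := congrArg (fun L => L (Pi.single i 1)) h.fderiv
  refine Eq.trans h' ?_
  fin_cases i <;> simp [pd] <;> ring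

theorem pd_eq_of_hasFDerivAt {i : Fin 3} {f : (Fin 3 → ℝ) → ℝ} {x : Fin 3 → ℝ}
    {L : (Fin 3 → ℝ) →L[ℝ] ℝ} (h : HasFDerivAt f L x) : pd i f x = L (Pi.single i 1) := by
  rw [pd, h.fderiv]

theorem jacobian_uex (x : Fin 3 → ℝ) :
    jacobian uex x = Real.exp (-(x 0 ^ 2 + x 1 ^ 2 + x 2 ^ 2)) •
      !![(1 - 2 * x 2 ^ 2) * (1 - 2 * x 0 ^ 2), -2 * (1 - 2 * x 2 ^ 2) * x 0 * x 1,
          x 0 * x 2 * (8 - 4 * (x 0 ^ 2 + x 1 ^ 2));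
        -2 * (1 - 2 * x 2 ^ 2) * x 0 * x 1, (1 - 2 * x 2 ^ 2) * (1 - 2 * x 1 ^ 2),
          x 1 * x 2 * (8 - 4 * (x 0 ^ 2 + x 1 ^ 2));
        x 0 * x 2 * (4 * x 2 ^ 2 - 6), x 1 * x 2 * (4 * x 2 ^ 2 - 6),
          -2 * (1 - 2 * x 2 ^ 2) * (1 - (x 0 ^ 2 + x 1 ^ 2))] := by
  have hc (k : Fin 3) := hasFDerivAt_apply (𝕜 := ℝ) k x
  have hz := (((hc 2).pow 2).const_mul 2).const_sub 1
  have h0 : HasFDerivAt (fun y : Fin 3 → ℝ => (1 - 2 * y 2 ^ 2) * y 0) _ x := hz.mul (hc 0)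
  have h1 : HasFDerivAt (fun y : Fin 3 → ℝ => (1 - 2 * y 2 ^ 2) * y 1) _ x := hz.mul (hc 1)
  have h2 : HasFDerivAt
      (fun y : Fin 3 → ℝ => -2 * y 2 + 2 * (y 0 ^ 2 + y 1 ^ 2) * y 2) _ x :=
    ((hc 2).const_mul (-2)).add (((((hc 0).pow 2).add ((hc 1).pow 2)).const_mul 2).mul (hc 2))
  ext i j
  fin_cases j
  · refine (pd_exp_neg_sq_mul i h0.differentiableAt).trans ?_
    rw [pd_eq_of_hasFDerivAt h0]
    fin_cases i <;> simp <;> ring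
  · refine (pd_exp_neg_sq_mul i h1.differentiableAt).trans ?_
    rw [pd_eq_of_hasFDerivAt h1]
    fin_cases i <;> simp <;> ring
  · refine (pd_exp_neg_sq_mul i h2.differentiableAt).trans ?_
    rw [pd_eq_of_hasFDerivAt h2]
    fin_cases i <;> simp <;> ring

theorem det_strain_uex (x : Fin 3 → ℝ) :
    (strain uex x).det = (1 - 2 * x 2 ^ 2) *
      (-2 * (1 - 2 * x 2 ^ 2) ^ 2 * (1 - 2 * (x 0 ^ 2 + x 1 ^ 2)) * (1 - (x 0 ^ 2 + x 1 ^ 2)) -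
        (x 0 ^ 2 + x 1 ^ 2) * x 2 ^ 2 * (1 + 2 * x 2 ^ 2 - 2 * (x 0 ^ 2 + x 1 ^ 2)) ^ 2) *
      Real.exp (-3 * (x 0 ^ 2 + x 1 ^ 2 + x 2 ^ 2)) := by
  have hexp : Real.exp (-3 * (x 0 ^ 2 + x 1 ^ 2 + x 2 ^ 2)) =
      Real.exp (-(x 0 ^ 2 + x 1 ^ 2 + x 2 ^ 2)) ^ 3 := by
    rw [← Real.exp_nat_mul]
    push_cast
    ring_nf
  rw [hexp, strain, jacobian_uex, Matrix.det_fin_three]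
  simp
  ring

theorem integral_det_strain_uex :
    ∫ x : Fin 3 → ℝ, (strain uex x).det = -(8 / 27) * √(Real.pi / 3) ^ 3 := by
  obtain ⟨h0, h2, h4, h6, h8⟩ := integral_pow_mul_exp_neg_three_mul_sq
  have h := ((((hasIntegral_radial_mul_gaussian 0 (m := 1) (by rw [h0, one_mul]) (-2) 6 (-4) 0).add
    (hasIntegral_radial_mul_gaussian 2 h2 12 (-37) 28 (-4))).add
    (hasIntegral_radial_mul_gaussian 4 h4 (-24) 70 (-48) 8)).add
    (hasIntegral_radial_mul_gaussian 6 h6 16 (-44) 16 0)).add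
    (hasIntegral_radial_mul_gaussian 8 h8 0 8 0 0)
  refine (h.congr (fun x => ?_) ?_).2
  · rw [det_strain_uex]
    ring
  · ring

theorem uex_neg_integral_det_strain_pos :
    (-∫ x : Fin 3 → ℝ, (strain uex x).det)
        = 8 * Real.pi ^ ((3 : ℝ) / 2) / (81 * Real.sqrt 3)
      ∧ 0 < -∫ x : Fin 3 → ℝ, (strain uex x).det := by
  have hsqrt : √(Real.pi / 3) ^ 3 = Real.pi ^ ((3 : ℝ) / 2) / (3 * √3) := by
    rw [Real.sqrt_div Real.pi_pos.le, div_pow, Real.sqrt_eq_rpow Real.pi, ← Real.rpow_natCast,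
      ← Real.rpow_mul Real.pi_pos.le, pow_succ (√3) 2, Real.sq_sqrt (by norm_num)]
    norm_num
  have hval : (-∫ x : Fin 3 → ℝ, (strain uex x).det)
      = 8 * Real.pi ^ ((3 : ℝ) / 2) / (81 * Real.sqrt 3) := by
    rw [integral_det_strain_uex, hsqrt]
    ring
  refine ⟨hval, ?_⟩
  rw [hval]
  positivity
end
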